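/- arXiv:1510.02318 — 2 statements merged into one kernel-verified Lean document; each statement's English description precedes it below -/
import Mathlib

section
/- Let Y be a binary random variable (taking each of its two values with positive probability) and X a random variable on a finite set jointly distributed with Y. Then g_0(X;Y) is equal either to H(Y) or to 0. -/
open scoped BigOperators Classical

/-- Shannon entropy (base 2) of a distribution on a finite alphabet,
with the convention `0 * logb 2 0 = 0`. -/
noncomputable def H {α : Type*} [Fintype α] (p : α → ℝ) : ℝ :=
  ∑ a, -(p a * Real.logb 2 (p a))

/-- `p` is a probability mass function on a finite alphabet. -/
def IsPMF {α : Type*} [Fintype α] (p : α → ℝ) : Prop :=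
  (∀ a, 0 ≤ p a) ∧ ∑ a, p a = 1

/-- First marginal of a joint distribution. -/
noncomputable def fstM {α β : Type*} [Fintype α] [Fintype β] (p : α × β → ℝ) : α → ℝ :=
  fun a => ∑ b, p (a, b)

/-- Second marginal of a joint distribution. -/
noncomputable def sndM {α β : Type*} [Fintype α] [Fintype β] (p : α × β → ℝ) : β → ℝ :=
  fun b => ∑ a, p (a, b)

/-- Mutual information (base 2) of a joint distribution. -/
noncomputable def MI {α β : Type*} [Fintype α] [Fintype β] (p : α × β → ℝ) : ℝ :=
  H (fstM p) + H (sndM p) - H p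

/-- Marginal on the first two coordinates of a triple. -/
noncomputable def m12 {α β γ : Type*} [Fintype α] [Fintype β] [Fintype γ]
    (q : α × β × γ → ℝ) : α × β → ℝ := fun ab => ∑ c, q (ab.1, ab.2, c)

/-- Marginal on the first and third coordinates of a triple. -/
noncomputable def m13 {α β γ : Type*} [Fintype α] [Fintype β] [Fintype γ]
    (q : α × β × γ → ℝ) : α × γ → ℝ := fun ac => ∑ b, q (ac.1, b, ac.2)

/-- Marginal on the last two coordinates of a triple. -/
noncomputable def m23 {α β γ : Type*} [Fintype α] [Fintype β] [Fintype γ]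
    (q : α × β × γ → ℝ) : β × γ → ℝ := fun bc => ∑ a, q (a, bc.1, bc.2)

/-- `A → B → C` is a Markov chain for a joint distribution `q` on `α × β × γ`:
`A` and `C` are conditionally independent given the middle variable `B`. -/
def Markov {α β γ : Type*} [Fintype α] [Fintype β] [Fintype γ]
    (q : α × β × γ → ℝ) : Prop :=
  ∀ a b c, q (a, b, c) * (∑ a', ∑ c', q (a', b, c')) =
    (∑ c', q (a, b, c')) * (∑ a', q (a', b, c))

/-- The set of achievable utilities `I(Y;Z)` over finite-valued `Z` with
`X → Y → Z` a Markov chain and privacy leakage `I(X;Z) ≤ ε`. -/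
def PrivSet {α β : Type*} [Fintype α] [Fintype β] (ε : ℝ) (p : α × β → ℝ) : Set ℝ :=
  { r | ∃ (γ : Type) (_ : Fintype γ) (q : α × β × γ → ℝ),
      IsPMF q ∧ m12 q = p ∧ Markov q ∧ MI (m13 q) ≤ ε ∧ r = MI (m23 q) }

/-- The rate-privacy function `g_ε(X;Y)`. -/
noncomputable def g {α β : Type*} [Fintype α] [Fintype β] (ε : ℝ) (p : α × β → ℝ) : ℝ :=
  sSup (PrivSet ε p)

/-- The conditional distribution `P_{X|Y}(·|y)` (the zero map if `P_Y(y) = 0`). -/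
noncomputable def condX {α β : Type*} [Fintype α] [Fintype β] (p : α × β → ℝ) (y : β) :
    α → ℝ := fun x => p (x, y) / sndM p y

/-- `X` is weakly independent of `Y`: the family of conditional distributions
`P_{X|Y}(·|y)`, for `y` in the support of `P_Y`, is linearly dependent. -/
def WeaklyIndep {α β : Type*} [Fintype α] [Fintype β] (p : α × β → ℝ) : Prop :=
  ¬ LinearIndependent ℝ (fun y : {y : β // 0 < sndM p y} => condX p y.1)

/-- `C_X(Y)`: the minimum of `H(W)` over finite-valued `W` with `X → W → Y` a
Markov chain and `H(W|Y) = 0`, i.e. `W = f(Y)` for a deterministic `f`. -/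
noncomputable def Cmin {α β : Type*} [Fintype α] [Fintype β] (p : α × β → ℝ) : ℝ :=
  sInf { r | ∃ (γ : Type) (_ : Fintype γ) (f : β → γ),
      Markov (fun xwy : α × γ × β => if f xwy.2.2 = xwy.2.1 then p (xwy.1, xwy.2.2) else 0) ∧
      r = H (fun w : γ => ∑ y, if f y = w then sndM p y else 0) }

/-- Common entropy `G(X;Y)`: the minimum of `H(W)` over finite-valued `W`
with `X → W → Y` a Markov chain. -/
noncomputable def Gmin {α β : Type*} [Fintype α] [Fintype β] (p : α × β → ℝ) : ℝ :=
  sInf { r | ∃ (γ : Type) (_ : Fintype γ) (q : α × γ × β → ℝ),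
      IsPMF q ∧ m13 q = p ∧ Markov q ∧ r = H (fstM (m23 q)) }

/-- Entropy of the push-forward of the distribution `pY` under the map `f`. -/
noncomputable def Hpush {β S : Type*} [Fintype β] (pY : β → ℝ) (f : β → S) : ℝ :=
  letI := Classical.decEq S
  ∑ t ∈ Finset.image f Finset.univ,
    -((∑ y ∈ Finset.univ.filter fun y => f y = t, pY y) *
      Real.logb 2 (∑ y ∈ Finset.univ.filter fun y => f y = t, pY y))

theorem H_mul_log_two {α : Type*} [Fintype α] (p : α → ℝ) :
    H p * Real.log 2 = -∑ a, p a * Real.log (p a) := by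
  have h2 : Real.log 2 ≠ 0 := (Real.log_pos one_lt_two).ne'
  rw [H, Finset.sum_mul, ← Finset.sum_neg_distrib]
  refine Finset.sum_congr rfl fun a _ => ?_
  rw [Real.logb]
  field_simp

theorem sum_fstM_mul {α β : Type*} [Fintype α] [Fintype β] (r : α × β → ℝ) (u : α → ℝ) :
    ∑ a, fstM r a * u a = ∑ ab : α × β, r ab * u ab.1 := by
  simp only [fstM, Fintype.sum_prod_type, Finset.sum_mul]

theorem sum_sndM_mul {α β : Type*} [Fintype α] [Fintype β] (r : α × β → ℝ) (u : β → ℝ) :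
    ∑ b, sndM r b * u b = ∑ ab : α × β, r ab * u ab.2 := by
  simp only [sndM, Fintype.sum_prod_type_right, Finset.sum_mul]

theorem sum_fstM {α β : Type*} [Fintype α] [Fintype β] (r : α × β → ℝ) :
    ∑ a, fstM r a = ∑ ab, r ab := by
  simpa using sum_fstM_mul r 1

theorem sum_sndM {α β : Type*} [Fintype α] [Fintype β] (r : α × β → ℝ) :
    ∑ b, sndM r b = ∑ ab, r ab := by
  simpa using sum_sndM_mul r 1

/-- Mutual information, in nats, as an expected log-likelihood ratio. -/
theorem MI_mul_log_two {α β : Type*} [Fintype α] [Fintype β] (r : α × β → ℝ) :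
    MI r * Real.log 2 = ∑ ab : α × β,
      r ab * (Real.log (r ab) - Real.log (fstM r ab.1) - Real.log (sndM r ab.2)) := by
  rw [MI, sub_mul, add_mul, H_mul_log_two, H_mul_log_two, H_mul_log_two,
    sum_fstM_mul r fun a => Real.log (fstM r a), sum_sndM_mul r fun b => Real.log (sndM r b)]
  simp only [mul_sub, Finset.sum_sub_distrib]
  ring

theorem le_fstM {α β : Type*} [Fintype α] [Fintype β] {r : α × β → ℝ} (hr : ∀ ab, 0 ≤ r ab)
    (a : α) (b : β) : r (a, b) ≤ fstM r a :=
  Finset.single_le_sum (f := fun b => r (a, b)) (fun b _ => hr (a, b)) (Finset.mem_univ b)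

theorem le_sndM {α β : Type*} [Fintype α] [Fintype β] {r : α × β → ℝ} (hr : ∀ ab, 0 ≤ r ab)
    (a : α) (b : β) : r (a, b) ≤ sndM r b :=
  Finset.single_le_sum (f := fun a => r (a, b)) (fun a _ => hr (a, b)) (Finset.mem_univ a)

/-- The pointwise form of Gibbs' inequality, strict away from equality. -/
theorem sub_lt_mul_log_sub_log {x u v : ℝ} (hx : 0 ≤ x) (hu : x ≤ u) (hv : x ≤ v)
    (hne : x ≠ u * v) : x - u * v < x * (Real.log x - Real.log u - Real.log v) := by
  rcases hx.eq_or_lt with rfl | hx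
  · have : 0 < u * v := (mul_nonneg hu hv).lt_of_ne hne
    simpa using this
  · have hu' := hx.trans_le hu
    have hv' := hx.trans_le hv
    have h := Real.log_lt_sub_one_of_pos (x := u * v / x) (by positivity)
      fun h => hne (by field_simp at h; exact h.symm)
    rw [Real.log_div (by positivity) hx.ne', Real.log_mul hu'.ne' hv'.ne'] at h
    have h' := mul_lt_mul_of_pos_left h hx
    have hc : x * (u * v / x - 1) = u * v - x := by field_simp
    rw [hc] at h'
    linarith

theorem eq_mul_of_MI_nonpos {α β : Type*} [Fintype α] [Fintype β] {r : α × β → ℝ}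
    (hr : IsPMF r) (h : MI r ≤ 0) (a : α) (b : β) : r (a, b) = fstM r a * sndM r b := by
  by_contra hne
  have key : ∑ ab : α × β, (r ab - fstM r ab.1 * sndM r ab.2) < MI r * Real.log 2 := by
    rw [MI_mul_log_two]
    refine Finset.sum_lt_sum (fun ab _ => ?_) ⟨(a, b), Finset.mem_univ _, ?_⟩
    · by_cases hab : r ab = fstM r ab.1 * sndM r ab.2
      · rw [← hab, sub_self]
        rcases (hr.1 ab).eq_or_lt with h0 | h0
        · simp [← h0]
        · have h1 : 0 < fstM r ab.1 := h0.trans_le (le_fstM hr.1 ab.1 ab.2)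
          have h2 : 0 < sndM r ab.2 := h0.trans_le (le_sndM hr.1 ab.1 ab.2)
          rw [hab, Real.log_mul h1.ne' h2.ne']
          simp
      · exact (sub_lt_mul_log_sub_log (hr.1 ab) (le_fstM hr.1 ab.1 ab.2)
          (le_sndM hr.1 ab.1 ab.2) hab).le
    · exact sub_lt_mul_log_sub_log (hr.1 (a, b)) (le_fstM hr.1 a b) (le_sndM hr.1 a b) hne
  have hsum : ∑ ab : α × β, (r ab - fstM r ab.1 * sndM r ab.2) = 0 := by
    rw [Finset.sum_sub_distrib, Fintype.sum_prod_type (fun ab : α × β => fstM r ab.1 * sndM r ab.2),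
      ← Finset.sum_mul_sum, sum_fstM, sum_sndM, hr.2]
    simp
  rw [hsum] at key
  exact h.not_gt (pos_of_mul_pos_left key (Real.log_pos one_lt_two).le)

theorem MI_eq_zero_of_eq_mul {α β : Type*} [Fintype α] [Fintype β] {r : α × β → ℝ}
    (h : ∀ a b, r (a, b) = fstM r a * sndM r b) : MI r = 0 := by
  have h2 : Real.log 2 ≠ 0 := (Real.log_pos one_lt_two).ne'
  have : MI r * Real.log 2 = 0 := by
    rw [MI_mul_log_two]
    refine Finset.sum_eq_zero fun ab _ => ?_
    have hab := h ab.1 ab.2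
    rcases eq_or_ne (r ab) 0 with h0 | h0
    · simp [h0]
    · have hm : fstM r ab.1 * sndM r ab.2 ≠ 0 := hab ▸ h0
      rw [show r ab = _ from hab, Real.log_mul (left_ne_zero_of_mul hm) (right_ne_zero_of_mul hm)]
      simp
  exact (mul_eq_zero.1 this).resolve_right h2

theorem MI_le_H_fstM {α β : Type*} [Fintype α] [Fintype β] {r : α × β → ℝ}
    (hr : ∀ ab, 0 ≤ r ab) : MI r ≤ H (fstM r) := by
  have h : H (sndM r) * Real.log 2 ≤ H r * Real.log 2 := by
    rw [H_mul_log_two, H_mul_log_two, sum_sndM_mul r fun b => Real.log (sndM r b), neg_le_neg_iff]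
    refine Finset.sum_le_sum fun ab _ => ?_
    rcases (hr ab).eq_or_lt with h0 | h0
    · simp [← h0]
    · exact mul_le_mul_of_nonneg_left (Real.log_le_log h0 (le_sndM hr ab.1 ab.2)) h0.le
  have := le_of_mul_le_mul_right h (Real.log_pos one_lt_two)
  rw [MI]
  linarith

theorem fstM_m13 {α β γ : Type*} [Fintype α] [Fintype β] [Fintype γ] (q : α × β × γ → ℝ) :
    fstM (m13 q) = fstM (m12 q) := by
  ext a
  exact Finset.sum_comm

theorem fstM_m23 {α β γ : Type*} [Fintype α] [Fintype β] [Fintype γ] (q : α × β × γ → ℝ) :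
    fstM (m23 q) = sndM (m12 q) := by
  ext b
  exact Finset.sum_comm

theorem sndM_m23 {α β γ : Type*} [Fintype α] [Fintype β] [Fintype γ] (q : α × β × γ → ℝ) :
    sndM (m23 q) = sndM (m13 q) := by
  ext c
  exact Finset.sum_comm

theorem IsPMF.m13 {α β γ : Type*} [Fintype α] [Fintype β] [Fintype γ] {q : α × β × γ → ℝ}
    (hq : IsPMF q) : IsPMF (m13 q) := by
  refine ⟨fun ac => Finset.sum_nonneg fun b _ => hq.1 _, ?_⟩
  rw [← hq.2]
  simp only [_root_.m13, Fintype.sum_prod_type]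
  exact Finset.sum_congr rfl fun a _ => Finset.sum_comm

theorem H_diagonal {β : Type*} [Fintype β] (s : β → ℝ) :
    H (fun yz : β × β => if yz.1 = yz.2 then s yz.1 else 0) = H s := by
  simp only [H, Fintype.sum_prod_type]
  refine Finset.sum_congr rfl fun y _ => ?_
  rw [Finset.sum_eq_single y] <;> simp +contextual [eq_comm]

/-- If `X` and `Y` are independent then disclosing `Y` itself leaks nothing about `X`. -/
theorem H_sndM_mem_PrivSet {α : Type*} {β : Type} [Fintype α] [Fintype β] {p : α × β → ℝ}
    (hp : IsPMF p) (hind : ∀ x y, p (x, y) = fstM p x * sndM p y) :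
    H (sndM p) ∈ PrivSet 0 p := by
  have h13 : m13 (fun t : α × β × β => if t.2.1 = t.2.2 then p (t.1, t.2.1) else 0) = p := by
    ext xz
    simp [m13]
  have h23 : m23 (fun t : α × β × β => if t.2.1 = t.2.2 then p (t.1, t.2.1) else 0) =
      fun yz => if yz.1 = yz.2 then sndM p yz.1 else 0 := by
    ext yz
    by_cases h : yz.1 = yz.2 <;> simp [m23, sndM, h]
  refine ⟨β, inferInstance, fun t => if t.2.1 = t.2.2 then p (t.1, t.2.1) else 0,
    ⟨fun t => ?_, ?_⟩, ?_, fun a b c => ?_, ?_, ?_⟩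
  · dsimp only
    split_ifs
    exacts [hp.1 _, le_rfl]
  · simp only [← hp.2, Fintype.sum_prod_type]
    simp
  · ext xy
    simp [m12]
  · by_cases h : b = c <;> simp [h]
  · rw [h13, MI_eq_zero_of_eq_mul hind]
  · rw [h23, MI, H_diagonal]
    have h1 : fstM (fun yz : β × β => if yz.1 = yz.2 then sndM p yz.1 else 0) = sndM p := by
      ext y
      simp [fstM]
    have h2 : sndM (fun yz : β × β => if yz.1 = yz.2 then sndM p yz.1 else 0) = sndM p := by
      ext y
      simp [sndM]
    rw [h1, h2]
    ring

/-- If `X` depends on the binary variable `Y`, then any `Z` with `X → Y → Z` that is independent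
of `X` is independent of `Y`. -/
theorem m23_eq_mul_of_dependent {α γ : Type*} [Fintype α] [Fintype γ] {q : α × Bool × γ → ℝ}
    (hq : Markov q) (hpos : ∀ y, 0 < sndM (m12 q) y)
    (hdep : ∃ x y, m12 q (x, y) ≠ fstM (m12 q) x * sndM (m12 q) y)
    (htot : ∑ y, sndM (m12 q) y = 1)
    (hind : ∀ x z, m13 q (x, z) = fstM (m13 q) x * sndM (m13 q) z) (y : Bool) (z : γ) :
    m23 q (y, z) = fstM (m23 q) y * sndM (m23 q) z := by
  obtain ⟨x, y₀, hx⟩ := hdep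
  have hm : ∀ y, q (x, y, z) = m12 q (x, y) * m23 q (y, z) / sndM (m12 q) y := fun y =>
    (eq_div_iff (hpos y).ne').2 (hq x y z)
  have hxz : q (x, true, z) + q (x, false, z) = fstM (m12 q) x * sndM (m23 q) z := by
    rw [sndM_m23, ← fstM_m13, ← hind x z]
    simp [m13]
  have hfx : fstM (m12 q) x = m12 q (x, true) + m12 q (x, false) := by simp [fstM]
  have hz : sndM (m23 q) z = m23 q (true, z) + m23 q (false, z) := by simp [sndM]
  have ht := hpos true
  have hf := hpos false
  rw [Fintype.sum_bool] at htot
  rw [fstM_m23]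
  rw [hm, hm, hfx, hz] at hxz
  rw [hz]
  rw [hfx] at hx
  have hAB : m12 q (x, true) / sndM (m12 q) true - m12 q (x, false) / sndM (m12 q) false ≠ 0 := by
    intro h
    have h' : m12 q (x, true) * sndM (m12 q) false = m12 q (x, false) * sndM (m12 q) true :=
      (div_eq_div_iff ht.ne' hf.ne').1 (sub_eq_zero.1 h)
    apply hx
    cases y₀
    · linear_combination -m12 q (x, false) * htot - h'
    · linear_combination -m12 q (x, true) * htot + h'
  have hprod : (m12 q (x, true) / sndM (m12 q) true - m12 q (x, false) / sndM (m12 q) false) *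
      (m23 q (true, z) - sndM (m12 q) true * (m23 q (true, z) + m23 q (false, z))) = 0 := by
    rw [eq_sub_of_add_eq' htot] at hf hxz ⊢
    field_simp at hxz ⊢
    linear_combination hxz
  have hz' := (mul_eq_zero.1 hprod).resolve_left hAB
  cases y
  · linear_combination -hz' - (m23 q (true, z) + m23 q (false, z)) * htot
  · linear_combination hz'

/-- If `Y` is a binary random variable taking each of its two
values with positive probability, then `g₀(X;Y)` equals either `H(Y)` or `0`. -/
theorem stmt1 {𝒳 : Type*} [Fintype 𝒳] (p : 𝒳 × Bool → ℝ) (hp : IsPMF p)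
    (hpos : ∀ y : Bool, 0 < sndM p y) :
    g 0 p = H (sndM p) ∨ g 0 p = 0 := by
  by_cases hind : ∀ x y, p (x, y) = fstM p x * sndM p y
  · refine Or.inl (IsGreatest.csSup_eq ⟨H_sndM_mem_PrivSet hp hind, ?_⟩)
    rintro _ ⟨γ, _, q, hq, rfl, -, -, rfl⟩
    rw [← fstM_m23]
    exact MI_le_H_fstM fun _ => Finset.sum_nonneg fun _ _ => hq.1 _
  · push Not at hind
    have hsub : PrivSet 0 p ⊆ {0} := by
      rintro _ ⟨γ, _, q, hq, rfl, hM, h0, rfl⟩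
      exact MI_eq_zero_of_eq_mul (m23_eq_mul_of_dependent hM hpos hind
        (by rw [sum_sndM, hp.2]) (eq_mul_of_MI_nonpos hq.m13 h0))
    rcases Set.subset_singleton_iff_eq.1 hsub with h | h <;> simp [g, h]
end

section
/- (Data-processing inequality for C) Let U, X, Y be random variables on finite sets such that U → X → Y is a Markov chain. Then C_U(Y) ≤ C_X(Y). -/
open scoped BigOperators Classical

/-- Passing a kernel `k` through the first coordinate preserves the Markov property of
`X → f(Y) → Y`. -/
theorem Markov.kernel_comp {υ α β γ : Type*} [Fintype υ] [Fintype α] [Fintype β] [Fintype γ]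
    {p : α × β → ℝ} {q : υ × β → ℝ} {f : β → γ} (k : υ → α → ℝ)
    (hq : ∀ u y, q (u, y) = ∑ x, k u x * p (x, y)) (hpq : sndM q = sndM p)
    (h : Markov (fun xwy : α × γ × β => if f xwy.2.2 = xwy.2.1 then p (xwy.1, xwy.2.2) else 0)) :
    Markov (fun uwy : υ × γ × β => if f uwy.2.2 = uwy.2.1 then q (uwy.1, uwy.2.2) else 0) := by
  have fiber (w : γ) (y : β) :
      (∑ u, if f y = w then q (u, y) else 0) = ∑ x, if f y = w then p (x, y) else 0 := by
    split_ifs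
    · exact congrFun hpq y
    · simp
  have lin (u : υ) (w : γ) (y : β) : (if f y = w then q (u, y) else 0) =
      ∑ x, k u x * (if f y = w then p (x, y) else 0) := by
    split_ifs <;> simp [hq]
  have total (w : γ) : (∑ u, ∑ y, if f y = w then q (u, y) else 0) =
      ∑ x, ∑ y, if f y = w then p (x, y) else 0 := by
    rw [Finset.sum_comm]
    simp only [fiber]
    exact Finset.sum_comm
  have row (u : υ) (w : γ) : (∑ y, if f y = w then q (u, y) else 0) =
      ∑ x, k u x * ∑ y, if f y = w then p (x, y) else 0 := by
    simp only [lin, Finset.mul_sum]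
    exact Finset.sum_comm
  intro u w y
  have hx (x : α) := h x w y
  dsimp only at hx ⊢
  rw [total, fiber, lin, row]
  simp only [Finset.sum_mul _ (fun x => k u x * _), mul_assoc, hx]

/-- `X → Y → Y` is a Markov chain, also after an injective relabelling of `Y`. -/
theorem markov_of_injective {α β γ : Type*} [Fintype α] [Fintype β] [Fintype γ]
    (p : α × β → ℝ) {f : β → γ} (hf : Function.Injective f) :
    Markov (fun xwy : α × γ × β => if f xwy.2.2 = xwy.2.1 then p (xwy.1, xwy.2.2) else 0) := by
  intro a w y
  dsimp only
  by_cases h : f y = w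
  · subst h
    simp [hf.eq_iff]
  · simp [h]

theorem H_nonneg {α : Type*} [Fintype α] {p : α → ℝ} (hp : IsPMF p) : 0 ≤ H p := by
  refine Finset.sum_nonneg fun a _ => neg_nonneg.mpr ?_
  have ha : p a ≤ 1 := hp.2 ▸ Finset.single_le_sum (fun b _ => hp.1 b) (Finset.mem_univ a)
  exact mul_nonpos_of_nonneg_of_nonpos (hp.1 a)
    (Real.logb_nonpos (by norm_num) (hp.1 a) ha)

theorem IsPMF.pushforward {β γ : Type*} [Fintype β] [Fintype γ] {p : β → ℝ} (hp : IsPMF p)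
    (f : β → γ) : IsPMF (fun w : γ => ∑ y, if f y = w then p y else 0) := by
  refine ⟨fun w => Finset.sum_nonneg fun y _ => ?_, ?_⟩
  · split_ifs
    exacts [hp.1 y, le_rfl]
  · rw [Finset.sum_comm]
    simpa using hp.2

theorem IsPMF.sndM {α β : Type*} [Fintype α] [Fintype β] {p : α × β → ℝ} (hp : IsPMF p) :
    IsPMF (sndM p) := by
  refine ⟨fun y => Finset.sum_nonneg fun x _ => hp.1 (x, y), ?_⟩
  have h := hp.2
  rw [Fintype.sum_prod_type_right] at h
  exact h

theorem sndM_m13 {α β γ : Type*} [Fintype α] [Fintype β] [Fintype γ] (q : α × β × γ → ℝ) :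
    sndM (m13 q) = sndM (m23 q) :=
  funext fun _ => Finset.sum_comm

/-- For a Markov chain `A → B → C`, the law of `(A, C)` is obtained from that of `(B, C)` through
the conditional distribution of `A` given `B`. -/
theorem Markov.m13_eq {α β γ : Type*} [Fintype α] [Fintype β] [Fintype γ]
    {q : α × β × γ → ℝ} (hq : ∀ z, 0 ≤ q z) (h : Markov q) (a : α) (c : γ) :
    m13 q (a, c) =
      ∑ b, (∑ c', q (a, b, c')) / (∑ a', ∑ c', q (a', b, c')) * m23 q (b, c) := by
  refine Finset.sum_congr rfl fun b _ => ?_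
  by_cases hb : ∑ a', ∑ c', q (a', b, c') = 0
  · rw [Finset.sum_eq_zero_iff_of_nonneg
      fun a' _ => Finset.sum_nonneg fun c' _ => hq (a', b, c')] at hb
    have ha := hb a (Finset.mem_univ a)
    have hc := (Finset.sum_eq_zero_iff_of_nonneg fun c' _ => hq (a, b, c')).mp ha c
      (Finset.mem_univ c)
    simp [ha, hc]
  · rw [div_mul_eq_mul_div, eq_div_iff hb]
    exact h a b c

/-- data-processing inequality for `C`. If `U → X → Y` is a
Markov chain, then `C_U(Y) ≤ C_X(Y)`.  Here `m13 t` is the joint distribution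
of `(U,Y)` and `m23 t` that of `(X,Y)`. -/
theorem stmt9 {𝒰 𝒳 𝒴 : Type*} [Fintype 𝒰] [Fintype 𝒳] [Fintype 𝒴]
    (t : 𝒰 × 𝒳 × 𝒴 → ℝ) (ht : IsPMF t) (hM : Markov t) :
    Cmin (m13 t) ≤ Cmin (m23 t) := by
  refine csInf_le_csInf ⟨0, ?_⟩ ?_ ?_
  · rintro r ⟨γ, _, f, -, rfl⟩
    exact H_nonneg (ht.m13.sndM.pushforward f)
  · exact ⟨_, Fin (Fintype.card 𝒴), inferInstance, Fintype.equivFin 𝒴,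
      markov_of_injective _ (Fintype.equivFin 𝒴).injective, rfl⟩
  · rintro r ⟨γ, _, f, hf, rfl⟩
    refine ⟨γ, inferInstance, f, ?_, ?_⟩
    · exact hf.kernel_comp _ (fun u y => hM.m13_eq ht.1 u y) (sndM_m13 t)
    · rw [sndM_m13]
end
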